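/- For every angle θ with 0 < θ ≤ 0.0664·π, every action minimizer q of the action functional A over the admissible class P(Q_S, Q_{E₂}) is collision-free: for all t ∈ [0,1] and all indices i ≠ j one has qᵢ(t) ≠ qⱼ(t). -/

import Mathlib

open Real MeasureTheory Set
open scoped ENNReal

noncomputable section

/-- Euclidean norm on `ℝ × ℝ` (row vectors in the plane). -/
def enorm2 (v : ℝ × ℝ) : ℝ := Real.sqrt (v.1 ^ 2 + v.2 ^ 2)

/-- Row vector multiplied on the right by the rotation matrix `R θ`
with rows `(cos θ, sin θ)` and `(-sin θ, cos θ)`. -/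
def rotV (θ : ℝ) (v : ℝ × ℝ) : ℝ × ℝ :=
  (v.1 * Real.cos θ - v.2 * Real.sin θ, v.1 * Real.sin θ + v.2 * Real.cos θ)

/-- `H¹([0,1],(ℝ²)⁴)`: absolutely continuous paths `[0,1] → (ℝ²)⁴` with
square-integrable derivative, recorded via an integrable (a.e.-)derivative `v`
together with the integral representation of `q`. -/
structure H1Path4 where
  q : ℝ → Fin 4 → ℝ × ℝ
  v : ℝ → Fin 4 → ℝ × ℝ
  hvInt : ∀ i : Fin 4, IntegrableOn (fun t => v t i) (Icc (0:ℝ) 1)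
  hrep : ∀ i : Fin 4, ∀ t ∈ Icc (0:ℝ) 1, q t i = q 0 i + ∫ s in (0:ℝ)..t, v s i
  hL2 : ∀ i : Fin 4, IntegrableOn (fun t => enorm2 (v t i) ^ 2) (Icc (0:ℝ) 1)

/-- Center of mass at the origin throughout `[0,1]` (the path lies in `χ`). -/
def H1Path4.inChi (p : H1Path4) : Prop := ∀ t ∈ Icc (0:ℝ) 1, ∑ i, p.q t i = 0

/-- The Lagrangian action functional `A`, with value `+∞` allowed. -/
def action (p : H1Path4) : ℝ≥0∞ :=
  ∫⁻ t in Icc (0:ℝ) 1,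
    (ENNReal.ofReal ((1/2) * ∑ i, enorm2 (p.v t i) ^ 2)
      + ∑ i : Fin 4, ∑ j ∈ Finset.univ.filter (fun j => i < j),
          (ENNReal.ofReal (enorm2 (p.q t i - p.q t j)))⁻¹)

/-- The starting boundary configuration set `Q_S` (double isosceles with order
constraints). -/
def QSset : Set (Fin 4 → ℝ × ℝ) :=
  { c | ∃ a₁ b₁ c₁ : ℝ, 0 ≤ b₁ ∧ 0 ≤ c₁ ∧
      c = ![(-a₁ - c₁, 0), (-a₁, 0), ((2*a₁ + c₁)/2, b₁), ((2*a₁ + c₁)/2, -b₁)] }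

/-- The ending boundary configuration set `Q_{E₁}`. -/
def QE1set (θ : ℝ) : Set (Fin 4 → ℝ × ℝ) :=
  { c | ∃ a₂ b₂ c₂ : ℝ, 0 ≤ b₂ ∧ 0 ≤ c₂ ∧
      c = fun i => rotV θ (![(-b₂, -a₂), (-c₂, a₂), (c₂, a₂), (b₂, -a₂)] i) }

/-- The ending boundary configuration set `Q_{E₂}`. -/
def QE2set (θ : ℝ) : Set (Fin 4 → ℝ × ℝ) :=
  { c | ∃ a₂ b₂ c₂ : ℝ, 0 ≤ b₂ ∧ 0 ≤ c₂ ∧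
      c = fun i => rotV θ (![(-a₂, -b₂), (-a₂, b₂), (a₂, c₂), (a₂, -c₂)] i) }

/-- Membership in the admissible class `P(Q_S, E)`. -/
def inAdm (E : Set (Fin 4 → ℝ × ℝ)) (p : H1Path4) : Prop :=
  p.inChi ∧ p.q 0 ∈ QSset ∧ p.q 1 ∈ E

/-- `p` is an action minimizer over `P(Q_S, E)`. -/
def isMin (E : Set (Fin 4 → ℝ × ℝ)) (p : H1Path4) : Prop :=
  inAdm E p ∧ ∀ p' : H1Path4, inAdm E p' → action p ≤ action p'

/-- The Newtonian equations of the equal-mass four-body problem, on a set `s`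
of times. -/
def newton (Q : ℝ → Fin 4 → ℝ × ℝ) (s : Set ℝ) : Prop :=
  ∀ i : Fin 4, ∀ t ∈ s,
    deriv (deriv (fun u => Q u i)) t =
      ∑ j ∈ Finset.univ.erase i, (1 / enorm2 (Q t j - Q t i) ^ 3) • (Q t j - Q t i)

/-! ### Absolutely continuous functions -/

namespace AbsolutelyContinuousOnInterval

lemma of_abs_sub_le {f g h : ℝ → ℝ} {a b K : ℝ} (hf : AbsolutelyContinuousOnInterval f a b)
    (hg : AbsolutelyContinuousOnInterval g a b)
    (hle : ∀ x ∈ uIcc a b, ∀ y ∈ uIcc a b, |h x - h y| ≤ K * (|f x - f y| + |g x - g y|)) :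
    AbsolutelyContinuousOnInterval h a b := by
  have hlim := (Filter.Tendsto.add hf hg).const_mul K
  simp only [add_zero, mul_zero] at hlim
  refine squeeze_zero' (Filter.Eventually.of_forall fun E ↦ Finset.sum_nonneg fun i _ ↦ dist_nonneg)
    ?_ hlim
  filter_upwards [Filter.mem_inf_of_right (Filter.mem_principal_self _)] with E hE
  rw [← Finset.sum_add_distrib, Finset.mul_sum]
  refine Finset.sum_le_sum fun i hi ↦ ?_
  have := hE.1 i hi
  simpa only [Real.dist_eq] using hle _ this.1 _ this.2

lemma comp_abs_sub_le {f : ℝ → ℝ} {G : ℝ → ℝ} {a b : ℝ}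
    (hf : AbsolutelyContinuousOnInterval f a b) (hG : ∀ x y, |G x - G y| ≤ |x - y|) :
    AbsolutelyContinuousOnInterval (fun t ↦ G (f t)) a b :=
  of_abs_sub_le (K := 1) hf hf fun x _ y _ ↦ by
    have := hG (f x) (f y)
    have := abs_nonneg (f x - f y)
    linarith

lemma inv_of_ne_zero {f : ℝ → ℝ} {a b : ℝ} (hf : AbsolutelyContinuousOnInterval f a b)
    (h0 : ∀ t ∈ uIcc a b, f t ≠ 0) :
    AbsolutelyContinuousOnInterval (fun t ↦ (f t)⁻¹) a b := by
  obtain ⟨M, hM⟩ := isCompact_uIcc.exists_bound_of_continuousOn (hf.continuousOn.inv₀ h0)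
  refine of_abs_sub_le (K := M ^ 2) hf hf fun x hx y hy ↦ ?_
  have hMx := hM x hx
  have hMy := hM y hy
  have h1 : (f x)⁻¹ - (f y)⁻¹ = (f x)⁻¹ * (f y)⁻¹ * (f y - f x) := by
    field_simp [h0 x hx, h0 y hy]
  rw [h1, abs_mul, abs_mul, abs_sub_comm (f y)]
  rw [Real.norm_eq_abs] at hMx hMy
  have h2 : |(f x)⁻¹| * |(f y)⁻¹| ≤ M ^ 2 := by
    rw [sq]
    exact mul_le_mul hMx hMy (abs_nonneg _) ((abs_nonneg _).trans hMx)
  have := mul_le_mul_of_nonneg_right h2 (abs_nonneg (f x - f y))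
  nlinarith [abs_nonneg (f x - f y), sq_nonneg M]

lemma cot_comp {ψ : ℝ → ℝ} {a b : ℝ} (hψ : AbsolutelyContinuousOnInterval ψ a b)
    (h0 : ∀ t ∈ uIcc a b, sin (ψ t) ≠ 0) :
    AbsolutelyContinuousOnInterval (fun t ↦ cos (ψ t) * (sin (ψ t))⁻¹) a b :=
  (hψ.comp_abs_sub_le fun x y ↦ Real.abs_cos_sub_cos_le x y).mul
    ((hψ.comp_abs_sub_le fun x y ↦ Real.abs_sin_sub_sin_le x y).inv_of_ne_zero h0)

/-- A fundamental theorem of calculus inequality. -/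
lemma sub_le_integral {F h : ℝ → ℝ} {a b : ℝ} (hab : a ≤ b)
    (hF : AbsolutelyContinuousOnInterval F a b) (hh : IntervalIntegrable h volume a b)
    (hd : ∀ᵐ t, t ∈ Ioo a b → ∃ d, HasDerivAt F d t ∧ d ≤ h t) :
    F b - F a ≤ ∫ t in a..b, h t := by
  rw [← hF.integral_deriv_eq_sub]
  refine intervalIntegral.integral_mono_ae_restrict hab hF.intervalIntegrable_deriv hh ?_
  rw [Filter.EventuallyLE, ae_restrict_iff' measurableSet_Icc]
  filter_upwards [hd, Measure.ae_ne volume a, Measure.ae_ne volume b] with t ht hta htb htm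
  obtain ⟨d, hd, hle⟩ := ht ⟨lt_of_le_of_ne htm.1 hta.symm, lt_of_le_of_ne htm.2 htb⟩
  rwa [hd.deriv]

end AbsolutelyContinuousOnInterval

/-- `g` is an integrable a.e. derivative of `f` on `[0,1]`, and `f` is its primitive. -/
structure IsPrim (f g : ℝ → ℝ) : Prop where
  int : IntervalIntegrable g volume 0 1
  sq_int : IntervalIntegrable (fun t ↦ g t ^ 2) volume 0 1
  rep : ∀ t ∈ Icc (0:ℝ) 1, f t = f 0 + ∫ s in (0:ℝ)..t, g s

lemma IntervalIntegrable.mul_of_sq {f g : ℝ → ℝ} {a b : ℝ}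
    (hf : IntervalIntegrable f volume a b) (hg : IntervalIntegrable g volume a b)
    (hf2 : IntervalIntegrable (fun t ↦ f t ^ 2) volume a b)
    (hg2 : IntervalIntegrable (fun t ↦ g t ^ 2) volume a b) :
    IntervalIntegrable (fun t ↦ f t * g t) volume a b := by
  rw [intervalIntegrable_iff] at *
  refine Integrable.mono (hf2.add hg2) (hf.1.mul hg.1) (Filter.Eventually.of_forall fun t ↦ ?_)
  simp only [Pi.add_apply, Real.norm_eq_abs, abs_mul]
  rw [abs_of_nonneg (by positivity : 0 ≤ f t ^ 2 + g t ^ 2)]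
  nlinarith [sq_nonneg (|f t| - |g t|), sq_abs (f t), sq_abs (g t), abs_nonneg (f t),
    abs_nonneg (g t)]

namespace IsPrim

variable {f g f₁ g₁ f₂ g₂ : ℝ → ℝ}

lemma intervalIntegrable_sub (h : IsPrim f g) {a b : ℝ} (ha : a ∈ Icc (0:ℝ) 1)
    (hb : b ∈ Icc (0:ℝ) 1) : IntervalIntegrable g volume a b :=
  h.int.mono_set (by
    rw [uIcc_of_le zero_le_one]; exact uIcc_subset_Icc ha hb)

lemma const_mul (h : IsPrim f g) (c : ℝ) : IsPrim (fun t ↦ c * f t) (fun t ↦ c * g t) where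
  int := h.int.const_mul c
  sq_int := by simpa only [mul_pow] using h.sq_int.const_mul (c ^ 2)
  rep t ht := by rw [intervalIntegral.integral_const_mul, h.rep t ht]; ring

lemma add (h₁ : IsPrim f₁ g₁) (h₂ : IsPrim f₂ g₂) :
    IsPrim (fun t ↦ f₁ t + f₂ t) (fun t ↦ g₁ t + g₂ t) where
  int := h₁.int.add h₂.int
  sq_int := by
    have := (h₁.sq_int.add h₂.sq_int).add
      ((h₁.int.mul_of_sq h₂.int h₁.sq_int h₂.sq_int).const_mul 2)
    exact this.congr fun t _ ↦ by ring
  rep t ht := by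
    have h0 : (0:ℝ) ∈ Icc (0:ℝ) 1 := by simp
    rw [intervalIntegral.integral_add (h₁.intervalIntegrable_sub h0 ht)
      (h₂.intervalIntegrable_sub h0 ht), h₁.rep t ht, h₂.rep t ht]
    ring

lemma sub (h₁ : IsPrim f₁ g₁) (h₂ : IsPrim f₂ g₂) :
    IsPrim (fun t ↦ f₁ t - f₂ t) (fun t ↦ g₁ t - g₂ t) := by
  simpa [sub_eq_add_neg] using h₁.add (h₂.const_mul (-1))

lemma absolutelyContinuous (h : IsPrim f g) : AbsolutelyContinuousOnInterval f 0 1 := by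
  have := h.int.absolutelyContinuousOnInterval_intervalIntegral (c := 0) (by simp)
  refine this.of_abs_sub_le this (K := 1) fun x hx y hy ↦ ?_
  rw [uIcc_of_le zero_le_one] at hx hy
  rw [h.rep x hx, h.rep y hy, add_sub_add_left_eq_sub, one_mul]
  exact le_add_of_nonneg_right (abs_nonneg _)

lemma continuousOn (h : IsPrim f g) : ContinuousOn f (Icc 0 1) := by
  simpa [uIcc_of_le zero_le_one] using h.absolutelyContinuous.continuousOn

lemma ae_hasDerivAt (h : IsPrim f g) : ∀ᵐ t, t ∈ Ioo (0:ℝ) 1 → HasDerivAt f (g t) t := by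
  filter_upwards [h.int.ae_hasDerivAt_integral] with t ht htm
  have h1 := (ht (by rw [uIcc_of_le zero_le_one]; exact Ioo_subset_Icc_self htm) 0
    (by simp)).const_add (f 0)
  refine h1.congr_of_eventuallyEq ?_
  filter_upwards [Ioo_mem_nhds htm.1 htm.2] with s hs
  exact h.rep s (Ioo_subset_Icc_self hs)

lemma sq_intervalIntegrable (h : IsPrim f g) : IntervalIntegrable (fun t ↦ f t ^ 2) volume 0 1 :=
  ContinuousOn.intervalIntegrable (by
    rw [uIcc_of_le zero_le_one]; exact h.continuousOn.pow 2)

end IsPrim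

lemma hasDerivAt_cot_comp {ψ : ℝ → ℝ} {d t : ℝ} (hψ : HasDerivAt ψ d t) (h0 : sin (ψ t) ≠ 0) :
    HasDerivAt (fun t ↦ cos (ψ t) * (sin (ψ t))⁻¹)
      (-(1 + (cos (ψ t) * (sin (ψ t))⁻¹) ^ 2) * d) t := by
  convert! hψ.cos.mul (hψ.sin.inv h0) using 1
  simp only [Pi.inv_apply]
  field_simp
  ring

/-- The Riccati form of the one-dimensional Wirtinger inequality. -/
lemma IsPrim.wirtinger_riccati {w g : ℝ → ℝ} (h : IsPrim w g) {φ δ : ℝ} (hφ : 0 ≤ φ)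
    (hδ : 0 < δ) (hφδ : φ + δ < π) :
    φ * (cos (φ + δ) / sin (φ + δ)) * w 1 ^ 2 - φ * (cos δ / sin δ) * w 0 ^ 2 ≤
      (∫ t in (0:ℝ)..1, g t ^ 2) - φ ^ 2 * ∫ t in (0:ℝ)..1, w t ^ 2 := by
  have hψd : ∀ t, HasDerivAt (fun t ↦ φ * t + δ) φ t := fun t ↦ by
    simpa using ((hasDerivAt_id t).const_mul φ).add_const δ
  have hψ : AbsolutelyContinuousOnInterval (fun t ↦ φ * t + δ) 0 1 :=
    ContDiffOn.absolutelyContinuousOnInterval (by fun_prop)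
  have hsin : ∀ t ∈ Icc (0:ℝ) 1, sin (φ * t + δ) ≠ 0 := fun t ht ↦
    (sin_pos_of_pos_of_lt_pi (by nlinarith [mul_nonneg hφ ht.1]) (by nlinarith [ht.1, ht.2])).ne'
  have hF := ((hψ.cot_comp (by simpa [uIcc_of_le zero_le_one] using hsin)).const_mul φ).mul
    (h.absolutelyContinuous.mul h.absolutelyContinuous)
  have hint : IntervalIntegrable (fun t ↦ g t ^ 2 - φ ^ 2 * w t ^ 2) volume 0 1 :=
    h.sq_int.sub (h.sq_intervalIntegrable.const_mul _)
  have key := hF.sub_le_integral zero_le_one hint (by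
    filter_upwards [h.ae_hasDerivAt] with t ht htm
    have h1 := ht htm
    refine ⟨_, ((hasDerivAt_cot_comp (hψd t) (hsin t (Ioo_subset_Icc_self htm))).const_mul φ).mul
      (h1.mul h1), ?_⟩
    set P := cos (φ * t + δ) * (sin (φ * t + δ))⁻¹
    simp only [Pi.mul_apply]
    nlinarith [sq_nonneg (g t - φ * P * w t)])
  rw [intervalIntegral.integral_sub h.sq_int (h.sq_intervalIntegrable.const_mul _),
    intervalIntegral.integral_const_mul] at key
  simp only [Pi.mul_apply, mul_one, mul_zero, zero_add] at key
  simp only [div_eq_mul_inv]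
  linarith

/-- Wirtinger's inequality for planar paths joining two lines through the origin at angle `φ`. -/
lemma IsPrim.wirtinger_lines {wa ga wb gb : ℝ → ℝ} (ha : IsPrim wa ga) (hb : IsPrim wb gb)
    {φ : ℝ} (hφ : 0 < φ) (hφ' : φ < π / 2) (hb0 : wb 0 = 0)
    (h1 : (wa 1 * sin φ) ^ 2 = (wb 1 * cos φ) ^ 2) :
    φ ^ 2 * ((∫ t in (0:ℝ)..1, wa t ^ 2) + ∫ t in (0:ℝ)..1, wb t ^ 2) ≤
      (∫ t in (0:ℝ)..1, ga t ^ 2) + ∫ t in (0:ℝ)..1, gb t ^ 2 := by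
  have hs : 0 < sin φ := sin_pos_of_pos_of_lt_pi hφ (by linarith [pi_pos])
  have hc : 0 < cos φ := cos_pos_of_mem_Ioo ⟨by linarith, hφ'⟩
  have hA := ha.wirtinger_riccati hφ.le (δ := π / 2) (by linarith) (by linarith)
  rw [cos_add_pi_div_two, sin_add_pi_div_two, cos_pi_div_two] at hA
  have hB : φ * (cos φ / sin φ) * wb 1 ^ 2 ≤
      (∫ t in (0:ℝ)..1, gb t ^ 2) - φ ^ 2 * ∫ t in (0:ℝ)..1, wb t ^ 2 := by
    have hlim : Filter.Tendsto (fun δ ↦ φ * (cos (φ + δ) / sin (φ + δ)) * wb 1 ^ 2)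
        (nhdsWithin 0 (Ioi 0)) (nhds (φ * (cos (φ + 0) / sin (φ + 0)) * wb 1 ^ 2)) := by
      refine Filter.Tendsto.mono_left (ContinuousAt.tendsto ?_) nhdsWithin_le_nhds
      have : sin (φ + 0) ≠ 0 := by simpa using hs.ne'
      fun_prop (disch := assumption)
    rw [add_zero] at hlim
    refine le_of_tendsto hlim ?_
    filter_upwards [Ioo_mem_nhdsGT (show (0:ℝ) < π / 2 by linarith)] with δ hδ
    have := hb.wirtinger_riccati hφ.le hδ.1 (by linarith [hδ.2])
    rw [hb0] at this
    linarith
  have hC : φ * (-sin φ / cos φ) * wa 1 ^ 2 + φ * (cos φ / sin φ) * wb 1 ^ 2 = 0 := by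
    field_simp
    rw [mul_zero]
    linear_combination (-φ) * h1
  rw [zero_div, mul_zero, zero_mul, sub_zero] at hA
  linarith

/-- One-sided Gordon estimate on an interval, in calibrated form. -/
lemma IsPrim.gordon_aux {u₁ g₁ u₂ g₂ ψ : ℝ → ℝ} (h₁ : IsPrim u₁ g₁) (h₂ : IsPrim u₂ g₂)
    {a b c : ℝ} (ha : 0 ≤ a) (hab : a ≤ b) (hb : b ≤ 1)
    (hψ : AbsolutelyContinuousOnInterval ψ a b)
    (hψd : ∀ᵐ t, t ∈ Ioo a b → HasDerivAt ψ (c * (1 / √(u₁ t ^ 2 + u₂ t ^ 2))) t)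
    (hpos : ∀ᵐ t, t ∈ Ioo a b → 0 < √(u₁ t ^ 2 + u₂ t ^ 2))
    (hsin : ∀ t ∈ Icc a b, sin (ψ t) ≠ 0) :
    2 * c * (cos (ψ b) / sin (ψ b)) * √(u₁ b ^ 2 + u₂ b ^ 2) -
      2 * c * (cos (ψ a) / sin (ψ a)) * √(u₁ a ^ 2 + u₂ a ^ 2) ≤
      ∫ t in a..b, (1 / 2 * (g₁ t ^ 2 + g₂ t ^ 2) - 2 * c ^ 2) := by
  have hsub : Icc a b ⊆ Icc (0:ℝ) 1 := Icc_subset_Icc ha hb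
  have hsub' : uIcc a b ⊆ uIcc (0:ℝ) 1 := by
    rwa [uIcc_of_le hab, uIcc_of_le zero_le_one]
  have hr : AbsolutelyContinuousOnInterval (fun t ↦ √(u₁ t ^ 2 + u₂ t ^ 2)) a b := by
    refine (h₁.absolutelyContinuous.mono hsub').of_abs_sub_le (h₂.absolutelyContinuous.mono hsub')
      (K := 1) fun x _ y _ ↦ ?_
    have e : ∀ t, √(u₁ t ^ 2 + u₂ t ^ 2) = ‖(⟨u₁ t, u₂ t⟩ : ℂ)‖ := fun t ↦ by
      rw [Complex.norm_eq_sqrt_sq_add_sq]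
    rw [e, e, one_mul]
    refine (abs_norm_sub_norm_le _ _).trans ((Complex.norm_le_abs_re_add_abs_im _).trans ?_)
    simp
  have hF := ((hψ.cot_comp (by simpa [uIcc_of_le hab] using hsin)).const_mul (2 * c)).mul hr
  have hint : IntervalIntegrable (fun t ↦ 1 / 2 * (g₁ t ^ 2 + g₂ t ^ 2) - 2 * c ^ 2)
      volume a b :=
    (((h₁.sq_int.add h₂.sq_int).const_mul (1 / 2)).mono_set hsub').sub (by simp)
  have key := hF.sub_le_integral hab hint (by
    filter_upwards [h₁.ae_hasDerivAt, h₂.ae_hasDerivAt, hψd, hpos] with t ht₁ ht₂ htψ htr htm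
    have htm' : t ∈ Ioo (0:ℝ) 1 := Ioo_subset_Ioo ha hb htm
    have hr0 := htr htm
    have hsq : 0 < u₁ t ^ 2 + u₂ t ^ 2 := Real.sqrt_pos.1 hr0
    have hrd := (((ht₁ htm').pow 2).add ((ht₂ htm').pow 2)).sqrt hsq.ne'
    refine ⟨_, ((hasDerivAt_cot_comp (htψ htm)
      (hsin t (Ioo_subset_Icc_self htm))).const_mul (2 * c)).mul hrd, ?_⟩
    set P := cos (ψ t) * (sin (ψ t))⁻¹
    have hR : √(u₁ t ^ 2 + u₂ t ^ 2) ^ 2 = u₁ t ^ 2 + u₂ t ^ 2 := Real.sq_sqrt hsq.le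
    simp only [Pi.add_apply, Pi.pow_apply]
    set R := √(u₁ t ^ 2 + u₂ t ^ 2)
    have e : 2 * c * (-(1 + P ^ 2) * (c * (1 / R))) * R + 2 * c * P *
        ((((2:ℕ):ℝ) * u₁ t ^ (2 - 1) * g₁ t + ((2:ℕ):ℝ) * u₂ t ^ (2 - 1) * g₂ t) / (2 * R))
        = -2 * c ^ 2 * (1 + P ^ 2) + 2 * c * P * ((u₁ t / R) * g₁ t + (u₂ t / R) * g₂ t) := by
      field_simp
      push_cast
      ring
    rw [e]
    have h1 : (u₁ t / R) ^ 2 + (u₂ t / R) ^ 2 = 1 := by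
      field_simp
      linarith
    have h2 : -2 * c ^ 2 * P ^ 2 = -2 * c ^ 2 * P ^ 2 * ((u₁ t / R) ^ 2 + (u₂ t / R) ^ 2) := by
      rw [h1, mul_one]
    nlinarith [sq_nonneg (g₁ t - 2 * c * P * (u₁ t / R)),
      sq_nonneg (g₂ t - 2 * c * P * (u₂ t / R))])
  simp only [Pi.mul_apply] at key
  simpa only [div_eq_mul_inv, one_mul] using key

/-- **Gordon's inequality** for planar paths on `[0,1]` passing through the origin. -/
lemma IsPrim.gordon {u₁ g₁ u₂ g₂ : ℝ → ℝ} (h₁ : IsPrim u₁ g₁) (h₂ : IsPrim u₂ g₂) {τ : ℝ}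
    (hτ : τ ∈ Icc (0:ℝ) 1) (hu₁ : u₁ τ = 0) (hu₂ : u₂ τ = 0)
    (hpos : ∀ᵐ t, t ∈ Icc (0:ℝ) 1 → 0 < √(u₁ t ^ 2 + u₂ t ^ 2))
    (hint : IntervalIntegrable (fun t ↦ 1 / √(u₁ t ^ 2 + u₂ t ^ 2)) volume 0 1) :
    π ^ 2 ≤ (∫ t in (0:ℝ)..1, 1 / √(u₁ t ^ 2 + u₂ t ^ 2)) ^ 2 *
      ((∫ t in (0:ℝ)..1, g₁ t ^ 2) + ∫ t in (0:ℝ)..1, g₂ t ^ 2) := by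
  set S := ∫ t in (0:ℝ)..1, 1 / √(u₁ t ^ 2 + u₂ t ^ 2) with hSdef
  set E := (∫ t in (0:ℝ)..1, g₁ t ^ 2) + ∫ t in (0:ℝ)..1, g₂ t ^ 2 with hEdef
  set s : ℝ → ℝ := fun t ↦ ∫ x in (0:ℝ)..t, 1 / √(u₁ x ^ 2 + u₂ x ^ 2) with hs
  have hsub : ∀ a ∈ Icc (0:ℝ) 1, ∀ b ∈ Icc (0:ℝ) 1, uIcc a b ⊆ uIcc (0:ℝ) 1 := fun a ha b hb ↦ by
    rw [uIcc_of_le zero_le_one]; exact uIcc_subset_Icc ha hb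
  have hmono : ∀ a ∈ Icc (0:ℝ) 1, ∀ b ∈ Icc (0:ℝ) 1, a ≤ b → s a ≤ s b := by
    intro a ha b hb hab
    have := intervalIntegral.integral_add_adjacent_intervals
      (hint.mono_set (hsub 0 (by simp) a ha)) (hint.mono_set (hsub a ha b hb))
    have h0 : 0 ≤ ∫ x in a..b, 1 / √(u₁ x ^ 2 + u₂ x ^ 2) :=
      intervalIntegral.integral_nonneg hab fun x _ ↦ by positivity
    simp only [hs]
    linarith
  have hs0 : s 0 = 0 := by simp [hs]
  have hs1 : s 1 = S := rfl
  have hsτ0 : 0 ≤ s τ := hs0 ▸ hmono 0 (by simp) τ hτ hτ.1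
  have hsτ1 : s τ ≤ S := hmono τ hτ 1 (by simp) hτ.2
  have hsd : ∀ᵐ t, t ∈ Icc (0:ℝ) 1 → HasDerivAt s (1 / √(u₁ t ^ 2 + u₂ t ^ 2)) t := by
    filter_upwards [hint.ae_hasDerivAt_integral] with t ht htm
    exact ht (by rwa [uIcc_of_le zero_le_one]) 0 (by simp)
  have hsac : AbsolutelyContinuousOnInterval s 0 1 :=
    hint.absolutelyContinuousOnInterval_intervalIntegral (by simp)
  have hψac : ∀ c k, AbsolutelyContinuousOnInterval (fun t ↦ c * s t + k) 0 1 := fun c k ↦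
    (hsac.const_mul c).fun_add (ContDiffOn.absolutelyContinuousOnInterval (by fun_prop))
  have key : ∀ c, 0 < c → c * S < π / 2 → 4 * c ^ 2 ≤ E := by
    intro c hc hcS
    have hδ : 0 < π / 2 - c * S := by linarith
    set δ := π / 2 - c * S with hδdef
    have hcot0 : ∀ x, 0 < x → x ≤ π / 2 → 0 < sin x ∧ 0 ≤ cos x := fun x hx hx' ↦
      ⟨sin_pos_of_pos_of_lt_pi hx (by linarith [pi_pos]), cos_nonneg_of_mem_Icc
        ⟨by linarith [pi_pos], hx'⟩⟩
    have hright : ∀ t ∈ Icc τ 1, 0 < c * s t + (δ - c * s τ) ∧ c * s t + (δ - c * s τ) ≤ π / 2 := by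
      intro t ht
      have htm : t ∈ Icc (0:ℝ) 1 := ⟨hτ.1.trans ht.1, ht.2⟩
      have e1 := mul_le_mul_of_nonneg_left (hmono τ hτ t htm ht.1) hc.le
      have e2 := mul_le_mul_of_nonneg_left (hmono t htm 1 (by simp) ht.2) hc.le
      have e3 := mul_nonneg hc.le hsτ0
      rw [hs1] at e2
      constructor <;> linarith
    have hleft : ∀ t ∈ Icc 0 τ,
        0 < -(c * s t + (-δ - c * s τ)) ∧ -(c * s t + (-δ - c * s τ)) ≤ π / 2 := by
      intro t ht
      have htm : t ∈ Icc (0:ℝ) 1 := ⟨ht.1, ht.2.trans hτ.2⟩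
      have e1 := mul_le_mul_of_nonneg_left (hmono t htm τ hτ ht.2) hc.le
      have e2 := mul_le_mul_of_nonneg_left (hmono 0 (by simp) t htm ht.1) hc.le
      have e3 := mul_le_mul_of_nonneg_left hsτ1 hc.le
      rw [hs0] at e2
      constructor <;> linarith
    have hR := h₁.gordon_aux h₂ (c := c) hτ.1 hτ.2 le_rfl
      ((hψac c (δ - c * s τ)).mono (hsub τ hτ 1 (by simp)))
      (by
        filter_upwards [hsd] with t ht htm
        exact ((ht ⟨hτ.1.trans htm.1.le, htm.2.le⟩).const_mul c).add_const _)
      (by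
        filter_upwards [hpos] with t ht htm
        exact ht ⟨hτ.1.trans htm.1.le, htm.2.le⟩)
      (fun t ht ↦ (hcot0 _ (hright t ht).1 (hright t ht).2).1.ne')
    have hL := h₁.gordon_aux h₂ (c := c) le_rfl hτ.1 hτ.2
      ((hψac c (-δ - c * s τ)).mono (hsub 0 (by simp) τ hτ))
      (by
        filter_upwards [hsd] with t ht htm
        exact ((ht ⟨htm.1.le, htm.2.le.trans hτ.2⟩).const_mul c).add_const _)
      (by
        filter_upwards [hpos] with t ht htm
        exact ht ⟨htm.1.le, htm.2.le.trans hτ.2⟩)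
      (fun t ht ↦ by
        have := (hcot0 _ (hleft t ht).1 (hleft t ht).2).1
        rw [sin_neg] at this
        linarith)
    have hz : √(u₁ τ ^ 2 + u₂ τ ^ 2) = 0 := by simp [hu₁, hu₂]
    have hI : IntervalIntegrable (fun t ↦ 1 / 2 * (g₁ t ^ 2 + g₂ t ^ 2) - 2 * c ^ 2)
        volume 0 1 := ((h₁.sq_int.add h₂.sq_int).const_mul (1 / 2)).sub (by simp)
    have hadd := intervalIntegral.integral_add_adjacent_intervals
      (hI.mono_set (hsub 0 (by simp) τ hτ)) (hI.mono_set (hsub τ hτ 1 (by simp)))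
    have htot : ∫ t in (0:ℝ)..1, (1 / 2 * (g₁ t ^ 2 + g₂ t ^ 2) - 2 * c ^ 2) =
        1 / 2 * E - 2 * c ^ 2 := by
      rw [intervalIntegral.integral_sub ((h₁.sq_int.add h₂.sq_int).const_mul (1 / 2)) (by simp),
        intervalIntegral.integral_const_mul, intervalIntegral.integral_add h₁.sq_int h₂.sq_int]
      simp [hEdef]
    rw [hz, mul_zero] at hR hL
    have hR' := hcot0 _ (hright 1 ⟨hτ.2, le_rfl⟩).1 (hright 1 ⟨hτ.2, le_rfl⟩).2
    have hL' := hcot0 _ (hleft 0 ⟨le_rfl, hτ.1⟩).1 (hleft 0 ⟨le_rfl, hτ.1⟩).2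
    rw [sin_neg, cos_neg] at hL'
    have e1 : 0 ≤ 2 * c * (cos (c * s 1 + (δ - c * s τ)) / sin (c * s 1 + (δ - c * s τ))) *
        √(u₁ 1 ^ 2 + u₂ 1 ^ 2) :=
      mul_nonneg (mul_nonneg (by linarith) (div_nonneg hR'.2 hR'.1.le)) (sqrt_nonneg _)
    have e2 : 2 * c * (cos (c * s 0 + (-δ - c * s τ)) / sin (c * s 0 + (-δ - c * s τ))) *
        √(u₁ 0 ^ 2 + u₂ 0 ^ 2) ≤ 0 :=
      mul_nonpos_of_nonpos_of_nonneg (mul_nonpos_of_nonneg_of_nonpos (by linarith)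
        (div_nonpos_of_nonneg_of_nonpos hL'.2 (by linarith [hL'.1]))) (sqrt_nonneg _)
    linarith
  have hS0 : 0 ≤ S := hsτ0.trans hsτ1
  have hE0 : 0 ≤ E := add_nonneg
    (intervalIntegral.integral_nonneg zero_le_one fun _ _ ↦ sq_nonneg _)
    (intervalIntegral.integral_nonneg zero_le_one fun _ _ ↦ sq_nonneg _)
  by_contra! hlt
  have h1 : S * √E < π := by
    refine lt_of_pow_lt_pow_left₀ 2 pi_pos.le ?_
    rwa [mul_pow, Real.sq_sqrt hE0]
  have hε : 0 < (π - S * √E) / (2 * (S + 1)) := div_pos (by linarith) (by linarith)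
  set ε := (π - S * √E) / (2 * (S + 1)) with hεdef
  have hεS : ε * (2 * (S + 1)) = π - S * √E := by
    rw [hεdef]; field_simp
  have := key ((√E + ε) / 2) (by positivity) (by nlinarith)
  nlinarith [Real.sq_sqrt hE0, Real.sqrt_nonneg E, mul_nonneg (Real.sqrt_nonneg E) hε.le]

/-- Scaling form of the arithmetic-geometric mean inequality for Kepler energies. -/
lemma le_add_of_cube_le {a p C E S : ℝ} (ha : 0 ≤ a) (hE : 0 ≤ E) (hS : 0 ≤ S)
    (hp : p ≤ S ^ 2 * E) (hC : 4 * C ^ 3 ≤ 27 * (a * p)) : C ≤ a * E + S := by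
  have hX : 0 ≤ a * E := mul_nonneg ha hE
  refine le_of_pow_le_pow_left₀ (n := 3) (by norm_num) (by linarith) ?_
  have h1 : a * p ≤ S ^ 2 * (a * E) := by
    have := mul_le_mul_of_nonneg_left hp ha
    linarith
  nlinarith [mul_nonneg (sq_nonneg (2 * (a * E) - S)) (by linarith : 0 ≤ a * E + 4 * S)]

section PairBounds

variable {u₁ g₁ u₂ g₂ : ℝ → ℝ}

lemma integral_sq_add_nonneg (g₁ g₂ : ℝ → ℝ) :
    0 ≤ (∫ t in (0:ℝ)..1, g₁ t ^ 2) + ∫ t in (0:ℝ)..1, g₂ t ^ 2 :=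
  add_nonneg (intervalIntegral.integral_nonneg zero_le_one fun _ _ ↦ sq_nonneg _)
    (intervalIntegral.integral_nonneg zero_le_one fun _ _ ↦ sq_nonneg _)

lemma IsPrim.collision_bound (h₁ : IsPrim u₁ g₁) (h₂ : IsPrim u₂ g₂) {τ : ℝ}
    (hτ : τ ∈ Icc (0:ℝ) 1) (hu₁ : u₁ τ = 0) (hu₂ : u₂ τ = 0)
    (hpos : ∀ᵐ t, t ∈ Icc (0:ℝ) 1 → 0 < √(u₁ t ^ 2 + u₂ t ^ 2))
    (hint : IntervalIntegrable (fun t ↦ 1 / √(u₁ t ^ 2 + u₂ t ^ 2)) volume 0 1)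
    {a C : ℝ} (ha : 0 ≤ a) (hC : 4 * C ^ 3 ≤ 27 * (a * π ^ 2)) :
    C ≤ a * ((∫ t in (0:ℝ)..1, g₁ t ^ 2) + ∫ t in (0:ℝ)..1, g₂ t ^ 2) +
      ∫ t in (0:ℝ)..1, 1 / √(u₁ t ^ 2 + u₂ t ^ 2) :=
  le_add_of_cube_le ha (integral_sq_add_nonneg _ _)
    (intervalIntegral.integral_nonneg zero_le_one fun _ _ ↦ by positivity)
    (h₁.gordon h₂ hτ hu₁ hu₂ hpos hint) hC

lemma IsPrim.moment_bound (h₁ : IsPrim u₁ g₁) (h₂ : IsPrim u₂ g₂)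
    (hpos : ∀ᵐ t, t ∈ Icc (0:ℝ) 1 → 0 < √(u₁ t ^ 2 + u₂ t ^ 2))
    (hint : IntervalIntegrable (fun t ↦ 1 / √(u₁ t ^ 2 + u₂ t ^ 2)) volume 0 1)
    {b C : ℝ} (hb : 0 ≤ b) (hC : 4 * C ^ 3 ≤ 27 * b) :
    C ≤ b * ((∫ t in (0:ℝ)..1, u₁ t ^ 2) + ∫ t in (0:ℝ)..1, u₂ t ^ 2) +
      ∫ t in (0:ℝ)..1, 1 / √(u₁ t ^ 2 + u₂ t ^ 2) := by
  have hs := (h₁.sq_intervalIntegrable.add h₂.sq_intervalIntegrable).const_mul b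
  rw [← intervalIntegral.integral_add h₁.sq_intervalIntegrable h₂.sq_intervalIntegrable,
    ← intervalIntegral.integral_const_mul, ← intervalIntegral.integral_add hs hint]
  have : C = ∫ _ in (0:ℝ)..1, C := by simp
  rw [this]
  refine intervalIntegral.integral_mono_ae_restrict zero_le_one (by simp) (hs.add hint) ?_
  rw [Filter.EventuallyLE, ae_restrict_iff' measurableSet_Icc]
  filter_upwards [hpos] with t ht htm
  have h0 := ht htm
  have hsq : √(u₁ t ^ 2 + u₂ t ^ 2) ^ 2 = u₁ t ^ 2 + u₂ t ^ 2 := Real.sq_sqrt (by positivity)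
  refine le_add_of_cube_le (p := 1) hb (by positivity) (by positivity) (le_of_eq ?_) (by simpa)
  rw [div_pow, one_pow, hsq, one_div_mul_cancel (Real.sqrt_pos.1 h0).ne']

lemma IsPrim.rotation_bound (h₁ : IsPrim u₁ g₁) (h₂ : IsPrim u₂ g₂)
    (hpos : ∀ᵐ t, t ∈ Icc (0:ℝ) 1 → 0 < √(u₁ t ^ 2 + u₂ t ^ 2))
    (hint : IntervalIntegrable (fun t ↦ 1 / √(u₁ t ^ 2 + u₂ t ^ 2)) volume 0 1)
    {φ a C : ℝ} (ha : 0 ≤ a)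
    (hw : φ ^ 2 * ((∫ t in (0:ℝ)..1, u₁ t ^ 2) + ∫ t in (0:ℝ)..1, u₂ t ^ 2) ≤
      (∫ t in (0:ℝ)..1, g₁ t ^ 2) + ∫ t in (0:ℝ)..1, g₂ t ^ 2)
    (hC : 4 * C ^ 3 ≤ 27 * (a * φ ^ 2)) :
    C ≤ a * ((∫ t in (0:ℝ)..1, g₁ t ^ 2) + ∫ t in (0:ℝ)..1, g₂ t ^ 2) +
      ∫ t in (0:ℝ)..1, 1 / √(u₁ t ^ 2 + u₂ t ^ 2) := by
  have h1 := h₁.moment_bound h₂ hpos hint (mul_nonneg ha (sq_nonneg φ)) hC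
  have h2 := mul_le_mul_of_nonneg_left hw ha
  linarith

end PairBounds

lemma sum_mul_integral_nonpos {n : ℕ} {f : Fin n → ℝ → ℝ} {c : Fin n → ℝ}
    (hf : ∀ k, IntervalIntegrable (f k) volume 0 1) (hle : ∀ t, ∑ k, c k * f k t ≤ 0) :
    ∑ k, c k * ∫ t in (0:ℝ)..1, f k t ≤ 0 := by
  simp_rw [← intervalIntegral.integral_const_mul]
  rw [← intervalIntegral.integral_finsetSum fun k _ ↦ (hf k).const_mul (c k)]
  rw [← neg_nonneg, ← intervalIntegral.integral_neg]
  exact intervalIntegral.integral_nonneg zero_le_one fun t _ ↦ neg_nonneg.2 (hle t)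

section Decomposition

variable {f g : Fin 4 → ℝ → ℝ}

/-- Splitting of the kinetic energy into the two binaries and their relative motion. -/
lemma kinetic_split_binaries (h : ∀ i, IsPrim (f i) (g i)) :
    1 / 4 * (∫ t in (0:ℝ)..1, (g 0 t - g 1 t) ^ 2) + 1 / 4 * (∫ t in (0:ℝ)..1, (g 2 t - g 3 t) ^ 2)
      + 1 / 2 * (∫ t in (0:ℝ)..1, (1 / 2 * (g 2 t + g 3 t - (g 0 t + g 1 t))) ^ 2) ≤
    1 / 2 * ∑ i, ∫ t in (0:ℝ)..1, g i t ^ 2 := by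
  have := sum_mul_integral_nonpos (n := 7)
    (f := ![fun t ↦ (g 0 t - g 1 t) ^ 2, fun t ↦ (g 2 t - g 3 t) ^ 2,
      fun t ↦ (1 / 2 * (g 2 t + g 3 t - (g 0 t + g 1 t))) ^ 2, fun t ↦ g 0 t ^ 2,
      fun t ↦ g 1 t ^ 2, fun t ↦ g 2 t ^ 2, fun t ↦ g 3 t ^ 2])
    (c := ![1 / 4, 1 / 4, 1 / 2, -1 / 2, -1 / 2, -1 / 2, -1 / 2])
    (by
      simp only [Fin.forall_fin_succ, IsEmpty.forall_iff, and_true]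
      exact ⟨((h 0).sub (h 1)).sq_int, ((h 2).sub (h 3)).sq_int,
        ((((h 2).add (h 3)).sub ((h 0).add (h 1))).const_mul (1 / 2)).sq_int,
        (h 0).sq_int, (h 1).sq_int, (h 2).sq_int, (h 3).sq_int⟩)
    (fun t ↦ by
      simp [Fin.sum_univ_succ]
      nlinarith [sq_nonneg (g 0 t + g 1 t + g 2 t + g 3 t)])
  simp [Fin.sum_univ_succ] at this ⊢
  linarith

lemma kinetic_split_pointwise (a b c d : ℝ) :
    1 / 6 * (a - c) ^ 2 + 1 / 8 * (a - b) ^ 2 + 1 / 8 * (c - d) ^ 2 ≤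
      1 / 2 * (a ^ 2 + b ^ 2 + c ^ 2 + d ^ 2) := by
  linarith [sq_nonneg (a + b + c + d), sq_nonneg (b - a - c + d), sq_nonneg (2 * b - c - d),
    sq_nonneg (a + b - 2 * d)]

/-- Splitting of the kinetic energy into the two binaries and one cross pair. -/
lemma kinetic_split_cross (h : ∀ i, IsPrim (f i) (g i)) {i j : Fin 4} (hi : i = 0 ∨ i = 1)
    (hj : j = 2 ∨ j = 3) :
    1 / 6 * (∫ t in (0:ℝ)..1, (g i t - g j t) ^ 2) + 1 / 8 * (∫ t in (0:ℝ)..1, (g 0 t - g 1 t) ^ 2)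
      + 1 / 8 * (∫ t in (0:ℝ)..1, (g 2 t - g 3 t) ^ 2) ≤
    1 / 2 * ∑ i, ∫ t in (0:ℝ)..1, g i t ^ 2 := by
  have := sum_mul_integral_nonpos (n := 7)
    (f := ![fun t ↦ (g i t - g j t) ^ 2, fun t ↦ (g 0 t - g 1 t) ^ 2,
      fun t ↦ (g 2 t - g 3 t) ^ 2, fun t ↦ g 0 t ^ 2,
      fun t ↦ g 1 t ^ 2, fun t ↦ g 2 t ^ 2, fun t ↦ g 3 t ^ 2])
    (c := ![1 / 6, 1 / 8, 1 / 8, -1 / 2, -1 / 2, -1 / 2, -1 / 2])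
    (by
      simp only [Fin.forall_fin_succ, IsEmpty.forall_iff, and_true]
      exact ⟨((h i).sub (h j)).sq_int, ((h 0).sub (h 1)).sq_int, ((h 2).sub (h 3)).sq_int,
        (h 0).sq_int, (h 1).sq_int, (h 2).sq_int, (h 3).sq_int⟩)
    (fun t ↦ by
      simp [Fin.sum_univ_succ]
      rcases hi with rfl | rfl <;> rcases hj with rfl | rfl
      · linarith [kinetic_split_pointwise (g 0 t) (g 1 t) (g 2 t) (g 3 t)]
      · linarith [kinetic_split_pointwise (g 0 t) (g 1 t) (g 3 t) (g 2 t)]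
      · linarith [kinetic_split_pointwise (g 1 t) (g 0 t) (g 2 t) (g 3 t)]
      · linarith [kinetic_split_pointwise (g 1 t) (g 0 t) (g 3 t) (g 2 t)])
  simp [Fin.sum_univ_succ] at this ⊢
  linarith

/-- The mutual cross moments are controlled by the moments of the two binaries and of their
relative position. -/
lemma cross_moment_le (h : ∀ i, IsPrim (f i) (g i)) :
    (∫ t in (0:ℝ)..1, (f 0 t - f 2 t) ^ 2) + (∫ t in (0:ℝ)..1, (f 0 t - f 3 t) ^ 2)
      + (∫ t in (0:ℝ)..1, (f 1 t - f 2 t) ^ 2) + (∫ t in (0:ℝ)..1, (f 1 t - f 3 t) ^ 2) ≤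
    (∫ t in (0:ℝ)..1, (f 0 t - f 1 t) ^ 2) + (∫ t in (0:ℝ)..1, (f 2 t - f 3 t) ^ 2)
      + 4 * ∫ t in (0:ℝ)..1, (1 / 2 * (f 2 t + f 3 t - (f 0 t + f 1 t))) ^ 2 := by
  have := sum_mul_integral_nonpos (n := 7)
    (f := ![fun t ↦ (f 0 t - f 2 t) ^ 2, fun t ↦ (f 0 t - f 3 t) ^ 2,
      fun t ↦ (f 1 t - f 2 t) ^ 2, fun t ↦ (f 1 t - f 3 t) ^ 2,
      fun t ↦ (f 0 t - f 1 t) ^ 2, fun t ↦ (f 2 t - f 3 t) ^ 2,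
      fun t ↦ (1 / 2 * (f 2 t + f 3 t - (f 0 t + f 1 t))) ^ 2])
    (c := ![1, 1, 1, 1, -1, -1, -4])
    (by
      simp only [Fin.forall_fin_succ, IsEmpty.forall_iff, and_true]
      exact ⟨((h 0).sub (h 2)).sq_intervalIntegrable, ((h 0).sub (h 3)).sq_intervalIntegrable,
        ((h 1).sub (h 2)).sq_intervalIntegrable, ((h 1).sub (h 3)).sq_intervalIntegrable,
        ((h 0).sub (h 1)).sq_intervalIntegrable, ((h 2).sub (h 3)).sq_intervalIntegrable,
        ((((h 2).add (h 3)).sub ((h 0).add (h 1))).const_mul (1 / 2)).sq_intervalIntegrable⟩)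
    (fun t ↦ by
      simp [Fin.sum_univ_succ]
      linarith)
  simp [Fin.sum_univ_succ] at this ⊢
  linarith

end Decomposition

lemma enorm2_sq (v : ℝ × ℝ) : enorm2 v ^ 2 = v.1 ^ 2 + v.2 ^ 2 :=
  Real.sq_sqrt (by positivity)

namespace H1Path4

variable (p : H1Path4)

lemma isPrim_fst (i : Fin 4) : IsPrim (fun t ↦ (p.q t i).1) (fun t ↦ (p.v t i).1) where
  int := (intervalIntegrable_iff_integrableOn_Icc_of_le zero_le_one).2 (p.hvInt i).fst
  sq_int := by
    refine (intervalIntegrable_iff_integrableOn_Icc_of_le zero_le_one).2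
      (Integrable.mono (p.hL2 i) ((p.hvInt i).fst.1.pow 2) (Filter.Eventually.of_forall fun t ↦ ?_))
    rw [enorm2_sq, Real.norm_of_nonneg (by positivity), Real.norm_of_nonneg (by positivity)]
    exact le_add_of_nonneg_right (sq_nonneg _)
  rep t ht := by
    have hi : IntervalIntegrable (fun t ↦ p.v t i) volume 0 t :=
      ((intervalIntegrable_iff_integrableOn_Icc_of_le zero_le_one).2 (p.hvInt i)).mono_set (by
        rw [uIcc_of_le zero_le_one, uIcc_of_le ht.1]; exact Icc_subset_Icc_right ht.2)
    have := (ContinuousLinearMap.fst ℝ ℝ ℝ).intervalIntegral_comp_comm hi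
    simp only [ContinuousLinearMap.coe_fst'] at this
    rw [p.hrep i t ht, this, Prod.fst_add]

lemma isPrim_snd (i : Fin 4) : IsPrim (fun t ↦ (p.q t i).2) (fun t ↦ (p.v t i).2) where
  int := (intervalIntegrable_iff_integrableOn_Icc_of_le zero_le_one).2 (p.hvInt i).snd
  sq_int := by
    refine (intervalIntegrable_iff_integrableOn_Icc_of_le zero_le_one).2
      (Integrable.mono (p.hL2 i) ((p.hvInt i).snd.1.pow 2) (Filter.Eventually.of_forall fun t ↦ ?_))
    rw [enorm2_sq, Real.norm_of_nonneg (by positivity), Real.norm_of_nonneg (by positivity)]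
    exact le_add_of_nonneg_left (sq_nonneg _)
  rep t ht := by
    have hi : IntervalIntegrable (fun t ↦ p.v t i) volume 0 t :=
      ((intervalIntegrable_iff_integrableOn_Icc_of_le zero_le_one).2 (p.hvInt i)).mono_set (by
        rw [uIcc_of_le zero_le_one, uIcc_of_le ht.1]; exact Icc_subset_Icc_right ht.2)
    have := (ContinuousLinearMap.snd ℝ ℝ ℝ).intervalIntegral_comp_comm hi
    simp only [ContinuousLinearMap.coe_snd'] at this
    rw [p.hrep i t ht, this, Prod.snd_add]

/-- The Newtonian potential of a pair along a path, as an extended nonnegative real. -/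
def pairPotential (i j : Fin 4) : ℝ≥0∞ :=
  ∫⁻ t in Icc (0:ℝ) 1, (ENNReal.ofReal (enorm2 (p.q t i - p.q t j)))⁻¹

lemma continuousOn_dist (i j : Fin 4) :
    ContinuousOn (fun t ↦ enorm2 (p.q t i - p.q t j)) (Icc 0 1) :=
  Real.continuous_sqrt.comp_continuousOn
    ((((p.isPrim_fst i).sub (p.isPrim_fst j)).continuousOn.pow 2).add
      (((p.isPrim_snd i).sub (p.isPrim_snd j)).continuousOn.pow 2))

lemma aemeasurable_inv_dist (i j : Fin 4) :
    AEMeasurable (fun t ↦ (ENNReal.ofReal (enorm2 (p.q t i - p.q t j)))⁻¹)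
      (volume.restrict (Icc (0:ℝ) 1)) :=
  ((p.continuousOn_dist i j).aemeasurable measurableSet_Icc).ennreal_ofReal.inv

lemma action_eq : action p =
    ENNReal.ofReal (1 / 2 * ∑ i, ∫ t in (0:ℝ)..1, (p.v t i).1 ^ 2 + (p.v t i).2 ^ 2) +
      ∑ i : Fin 4, ∑ j ∈ Finset.univ.filter (fun j ↦ i < j), p.pairPotential i j := by
  have hint : Integrable (fun t ↦ (1 / 2 : ℝ) * ∑ i, enorm2 (p.v t i) ^ 2)
      (volume.restrict (Icc (0:ℝ) 1)) :=
    (integrable_finsetSum _ fun i _ ↦ p.hL2 i).const_mul _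
  rw [action, lintegral_add_left' hint.1.aemeasurable.ennreal_ofReal,
    ← ofReal_integral_eq_lintegral_ofReal hint (Filter.Eventually.of_forall fun t ↦ by positivity)]
  congr 1
  · rw [integral_const_mul, integral_finsetSum _ fun i _ ↦ p.hL2 i]
    simp only [enorm2_sq, intervalIntegral.integral_of_le zero_le_one, integral_Icc_eq_integral_Ioc]
  · rw [lintegral_finsetSum' _ fun i _ ↦ Finset.aemeasurable_fun_sum _ fun j _ ↦
      p.aemeasurable_inv_dist i j]
    refine Finset.sum_congr rfl fun i _ ↦ ?_
    rw [lintegral_finsetSum' _ fun j _ ↦ p.aemeasurable_inv_dist i j]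
    rfl

lemma pairPotential_comm (i j : Fin 4) : p.pairPotential i j = p.pairPotential j i := by
  simp only [pairPotential, enorm2, Prod.fst_sub, Prod.snd_sub]
  simp only [sub_sq_comm]

variable {p}

lemma pairPotential_ne_top (h : action p ≠ ∞) {i j : Fin 4} (hij : i ≠ j) :
    p.pairPotential i j ≠ ∞ := by
  have key : ∀ i j : Fin 4, i < j → p.pairPotential i j ≠ ∞ := fun i j hij ↦ by
    rw [action_eq] at h
    refine ne_top_of_le_ne_top (ENNReal.add_ne_top.1 h).2 ?_
    exact (Finset.single_le_sum (f := fun j ↦ p.pairPotential i j) (fun _ _ ↦ zero_le)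
      (Finset.mem_filter.2 ⟨Finset.mem_univ j, hij⟩)).trans
      (Finset.single_le_sum (f := fun i : Fin 4 ↦
        ∑ j ∈ Finset.univ.filter (fun j ↦ i < j), p.pairPotential i j) (fun _ _ ↦ zero_le)
        (Finset.mem_univ i))
  rcases lt_or_gt_of_ne hij with hlt | hgt
  · exact key i j hlt
  · rw [pairPotential_comm]; exact key j i hgt

lemma ae_dist_pos (h : action p ≠ ∞) {i j : Fin 4} (hij : i ≠ j) :
    ∀ᵐ t, t ∈ Icc (0:ℝ) 1 → 0 < enorm2 (p.q t i - p.q t j) := by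
  rw [← ae_restrict_iff' measurableSet_Icc]
  filter_upwards [ae_lt_top' (p.aemeasurable_inv_dist i j) (pairPotential_ne_top h hij)] with t ht
  simpa using ht

lemma intervalIntegrable_inv_dist (h : action p ≠ ∞) {i j : Fin 4} (hij : i ≠ j) :
    IntervalIntegrable (fun t ↦ 1 / enorm2 (p.q t i - p.q t j)) volume 0 1 := by
  refine (intervalIntegrable_iff_integrableOn_Icc_of_le zero_le_one).2 ?_
  have := integrable_toReal_of_lintegral_ne_top (p.aemeasurable_inv_dist i j)
    (pairPotential_ne_top h hij)
  refine this.congr (Filter.Eventually.of_forall fun t ↦ ?_)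
  simp [ENNReal.toReal_ofReal (Real.sqrt_nonneg _), enorm2]

lemma pairPotential_eq (h : action p ≠ ∞) {i j : Fin 4} (hij : i ≠ j) :
    p.pairPotential i j =
      ENNReal.ofReal (∫ t in (0:ℝ)..1, 1 / enorm2 (p.q t i - p.q t j)) := by
  rw [intervalIntegral.integral_of_le zero_le_one, ← integral_Icc_eq_integral_Ioc,
    ofReal_integral_eq_lintegral_ofReal ((intervalIntegrable_iff_integrableOn_Icc_of_le
      zero_le_one).1 (intervalIntegrable_inv_dist h hij))
      (Filter.Eventually.of_forall fun t ↦ div_nonneg zero_le_one (Real.sqrt_nonneg _)),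
    pairPotential]
  refine lintegral_congr_ae ?_
  rw [Filter.EventuallyEq, ae_restrict_iff' measurableSet_Icc]
  filter_upwards [ae_dist_pos h hij] with t ht htm
  rw [one_div, ENNReal.ofReal_inv_of_pos (ht htm)]

lemma action_toReal_bound {U : ℝ} (hU : 0 ≤ U) (h : action p ≤ ENNReal.ofReal U) :
    1 / 2 * ∑ i, ((∫ t in (0:ℝ)..1, (p.v t i).1 ^ 2) + ∫ t in (0:ℝ)..1, (p.v t i).2 ^ 2) +
      ∑ i : Fin 4, ∑ j ∈ Finset.univ.filter (fun j ↦ i < j),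
        ∫ t in (0:ℝ)..1, 1 / enorm2 (p.q t i - p.q t j) ≤ U := by
  have htop : action p ≠ ∞ := ne_top_of_le_ne_top ENNReal.ofReal_ne_top h
  have hV : ∀ i j : Fin 4, 0 ≤ ∫ t in (0:ℝ)..1, 1 / enorm2 (p.q t i - p.q t j) := fun i j ↦
    intervalIntegral.integral_nonneg zero_le_one fun t _ ↦
      div_nonneg zero_le_one (Real.sqrt_nonneg _)
  have hK : ∀ i, 0 ≤ (∫ t in (0:ℝ)..1, (p.v t i).1 ^ 2) + ∫ t in (0:ℝ)..1, (p.v t i).2 ^ 2 :=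
    fun i ↦ integral_sq_add_nonneg _ _
  rw [← ENNReal.ofReal_le_ofReal_iff hU]
  convert h using 1
  rw [action_eq, ENNReal.ofReal_add
    (mul_nonneg (by norm_num) (Finset.sum_nonneg fun i _ ↦ hK i))
    (Finset.sum_nonneg fun i _ ↦ Finset.sum_nonneg fun j _ ↦ hV i j)]
  congr 1
  · simp only [intervalIntegral.integral_add (p.isPrim_fst _).sq_int (p.isPrim_snd _).sq_int]
  · rw [ENNReal.ofReal_sum_of_nonneg fun i _ ↦ Finset.sum_nonneg fun j _ ↦ hV i j]
    refine Finset.sum_congr rfl fun i _ ↦ ?_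
    rw [ENNReal.ofReal_sum_of_nonneg fun j _ ↦ hV i j]
    exact Finset.sum_congr rfl fun j hj ↦
      (pairPotential_eq htop (ne_of_lt (Finset.mem_filter.1 hj).2)).symm

end H1Path4

lemma H1Path4.action_le_of_pointwise {p : H1Path4} {U : ℝ}
    (hpos : ∀ t ∈ Icc (0:ℝ) 1, ∀ i j : Fin 4, i < j → 0 < enorm2 (p.q t i - p.q t j))
    (hle : ∀ t ∈ Icc (0:ℝ) 1, 1 / 2 * ∑ i, enorm2 (p.v t i) ^ 2 +
      ∑ i : Fin 4, ∑ j ∈ Finset.univ.filter (fun j ↦ i < j), (enorm2 (p.q t i - p.q t j))⁻¹ ≤ U) :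
    action p ≤ ENNReal.ofReal U := by
  refine (setLIntegral_mono' (g := fun _ ↦ ENNReal.ofReal U) measurableSet_Icc
    fun t ht ↦ ?_).trans (by simp)
  have hinv : ∀ i j : Fin 4, 0 ≤ (enorm2 (p.q t i - p.q t j))⁻¹ := fun i j ↦
    inv_nonneg.2 (Real.sqrt_nonneg _)
  refine le_trans (le_of_eq ?_) (ENNReal.ofReal_le_ofReal (hle t ht))
  rw [ENNReal.ofReal_add (by positivity)
    (Finset.sum_nonneg fun i _ ↦ Finset.sum_nonneg fun j _ ↦ hinv i j),
    ENNReal.ofReal_sum_of_nonneg fun i _ ↦ Finset.sum_nonneg fun j _ ↦ hinv i j]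
  congr 1
  refine Finset.sum_congr rfl fun i _ ↦ ?_
  rw [ENNReal.ofReal_sum_of_nonneg fun j _ ↦ hinv i j]
  exact Finset.sum_congr rfl fun j hj ↦
    (ENNReal.ofReal_inv_of_pos (hpos t ht i j (Finset.mem_filter.1 hj).2)).symm

/-- The path whose `i`-th body moves uniformly on the circle of signed radius `ρ i` with angular
velocity `ω i` and initial phase `α i`. -/
def circularPath (ρ ω α : Fin 4 → ℝ) : H1Path4 where
  q t i := (ρ i * cos (ω i * t + α i), ρ i * sin (ω i * t + α i))
  v t i := (ρ i * (-sin (ω i * t + α i) * ω i), ρ i * (cos (ω i * t + α i) * ω i))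
  hvInt i := Continuous.integrableOn_Icc (by fun_prop)
  hrep i t _ := by
    have hd : ∀ x : ℝ, HasDerivAt (fun t ↦ ω i * t + α i) (ω i) x := fun x ↦ by
      simpa using ((hasDerivAt_id x).const_mul (ω i)).add_const (α i)
    rw [intervalIntegral.integral_eq_sub_of_hasDerivAt
      (f := fun t ↦ (ρ i * cos (ω i * t + α i), ρ i * sin (ω i * t + α i)))
      (fun x _ ↦ ((hd x).cos.const_mul (ρ i)).prodMk ((hd x).sin.const_mul (ρ i)))
      (Continuous.intervalIntegrable (by fun_prop) _ _)]
    simp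
  hL2 i := Continuous.integrableOn_Icc (by simp only [enorm2_sq]; fun_prop)

lemma enorm2_circularPath_v_sq (ρ ω α : Fin 4 → ℝ) (t : ℝ) (i : Fin 4) :
    enorm2 ((circularPath ρ ω α).v t i) ^ 2 = (ρ i * ω i) ^ 2 := by
  rw [enorm2_sq]
  simp only [circularPath]
  linear_combination (ρ i * ω i) ^ 2 * sin_sq_add_cos_sq (ω i * t + α i)

lemma enorm2_circularPath_q_sub (ρ ω α : Fin 4 → ℝ) (t : ℝ) (i j : Fin 4) :
    enorm2 ((circularPath ρ ω α).q t i - (circularPath ρ ω α).q t j) =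
      √(ρ i ^ 2 + ρ j ^ 2 - 2 * ρ i * ρ j * cos (ω i * t + α i - (ω j * t + α j))) := by
  rw [enorm2, cos_sub]
  simp only [circularPath, Prod.fst_sub, Prod.snd_sub]
  congr 1
  linear_combination ρ i ^ 2 * sin_sq_add_cos_sq (ω i * t + α i) +
    ρ j ^ 2 * sin_sq_add_cos_sq (ω j * t + α j)

lemma add_sq_sub_pos {r R k : ℝ} (hr : 0 < r) (hrR : r < R) (hk : |k| ≤ 1) :
    0 < R ^ 2 + r ^ 2 - 2 * r * R * k := by
  nlinarith [mul_pos hr (hr.trans hrR), (abs_le.1 hk).2, sq_pos_of_pos (sub_pos.2 hrR),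
    mul_nonneg (mul_pos hr (hr.trans hrR)).le (sub_nonneg.2 (abs_le.1 hk).2)]

/-- The potential of a body under two antipodal bodies on a larger circle. -/
lemma inv_sqrt_add_inv_sqrt_le {r R k B : ℝ} (hr : 0 < r) (hrR : r < R) (hk : |k| ≤ 1)
    (hB : 0 ≤ B) (h : 4 * (R ^ 2 + r ^ 2) ≤ B ^ 2 * (R ^ 2 - r ^ 2) ^ 2) :
    (√(R ^ 2 + r ^ 2 - 2 * r * R * k))⁻¹ + (√(R ^ 2 + r ^ 2 + 2 * r * R * k))⁻¹ ≤ B := by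
  have h1 := add_sq_sub_pos hr hrR hk
  have h2 : 0 < R ^ 2 + r ^ 2 + 2 * r * R * k := by
    have := add_sq_sub_pos hr hrR (k := -k) (by rwa [abs_neg])
    linarith
  set x := √(R ^ 2 + r ^ 2 - 2 * r * R * k) with hx
  set y := √(R ^ 2 + r ^ 2 + 2 * r * R * k) with hy
  have hx0 : 0 < x := Real.sqrt_pos.2 h1
  have hy0 : 0 < y := Real.sqrt_pos.2 h2
  have hx2 : x ^ 2 = R ^ 2 + r ^ 2 - 2 * r * R * k := Real.sq_sqrt h1.le
  have hy2 : y ^ 2 = R ^ 2 + r ^ 2 + 2 * r * R * k := Real.sq_sqrt h2.le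
  have hxy : (R ^ 2 - r ^ 2) ^ 2 ≤ (x * y) ^ 2 := by
    rw [mul_pow, hx2, hy2]
    nlinarith [mul_nonneg (sq_nonneg (2 * r * R)) (sub_nonneg.2 ((sq_le_one_iff_abs_le_one k).2 hk))]
  have hsum : x + y ≤ B * (x * y) := by
    refine le_of_sq_le_sq ?_ (by positivity)
    rw [mul_pow]
    have := mul_le_mul_of_nonneg_left hxy (sq_nonneg B)
    nlinarith [sq_nonneg (x - y)]
  have hxy0 := mul_pos hx0 hy0
  rw [inv_add_inv hx0.ne' hy0.ne', div_le_iff₀ hxy0]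
  exact hsum

/-- Two antipodal pairs rotating uniformly: the inner binary on the circle of radius `r` makes
slightly more than a quarter turn while the outer one makes a small turn. -/
def testPath (r R θ : ℝ) : H1Path4 :=
  circularPath ![-r, r, R, -R] ![π / 2 + θ, π / 2 + θ, θ, θ] ![0, 0, π / 2, π / 2]

lemma testPath_inAdm {r R θ : ℝ} (hr : 0 ≤ r) (hR : 0 ≤ R) :
    inAdm (QE2set θ) (testPath r R θ) := by
  refine ⟨fun t _ ↦ ?_, ⟨-r, R, 2 * r, hR, by linarith, ?_⟩, ⟨0, r, R, hr, hR, ?_⟩⟩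
  · simp [testPath, circularPath, Fin.sum_univ_four]
  · funext i
    fin_cases i <;> simp [testPath, circularPath]
    ring
  · have h1 : cos (π / 2 + θ) = -sin θ := by rw [add_comm, cos_add_pi_div_two]
    have h2 : sin (π / 2 + θ) = cos θ := by rw [add_comm, sin_add_pi_div_two]
    funext i
    fin_cases i <;> simp [testPath, circularPath, rotV, h1, h2, cos_add_pi_div_two,
      sin_add_pi_div_two]

lemma action_testPath_le {r R θ B : ℝ} (hr : 0 < r) (hrR : r < R) (hB : 0 ≤ B)
    (h : 4 * (R ^ 2 + r ^ 2) ≤ B ^ 2 * (R ^ 2 - r ^ 2) ^ 2) :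
    action (testPath r R θ) ≤ ENNReal.ofReal
      ((r * (π / 2 + θ)) ^ 2 + (R * θ) ^ 2 + (2 * r)⁻¹ + (2 * R)⁻¹ + 2 * B) := by
  have hR : 0 < R := hr.trans hrR
  have hk : ∀ t : ℝ, |cos ((π / 2 + θ) * t - (θ * t + π / 2))| ≤ 1 := fun t ↦ abs_cos_le_one _
  have hd : ∀ t, enorm2 ((testPath r R θ).q t 0 - (testPath r R θ).q t 1) = 2 * r ∧
      enorm2 ((testPath r R θ).q t 2 - (testPath r R θ).q t 3) = 2 * R := fun t ↦ by
    simp only [testPath, enorm2_circularPath_q_sub]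
    constructor
    · rw [← Real.sqrt_sq (by positivity : 0 ≤ 2 * r)]
      simp
      ring_nf
    · rw [← Real.sqrt_sq (by positivity : 0 ≤ 2 * R)]
      simp
      ring_nf
  have hc : ∀ t, ∃ k : ℝ, |k| ≤ 1 ∧
      enorm2 ((testPath r R θ).q t 0 - (testPath r R θ).q t 2) =
        √(R ^ 2 + r ^ 2 + 2 * r * R * k) ∧
      enorm2 ((testPath r R θ).q t 0 - (testPath r R θ).q t 3) =
        √(R ^ 2 + r ^ 2 - 2 * r * R * k) ∧
      enorm2 ((testPath r R θ).q t 1 - (testPath r R θ).q t 2) =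
        √(R ^ 2 + r ^ 2 - 2 * r * R * k) ∧
      enorm2 ((testPath r R θ).q t 1 - (testPath r R θ).q t 3) =
        √(R ^ 2 + r ^ 2 + 2 * r * R * k) := fun t ↦ by
    refine ⟨cos ((π / 2 + θ) * t - (θ * t + π / 2)), abs_cos_le_one _, ?_⟩
    simp only [testPath, enorm2_circularPath_q_sub]
    refine ⟨?_, ?_, ?_, ?_⟩ <;> simp <;> ring_nf
  refine H1Path4.action_le_of_pointwise (fun t _ i j hij ↦ ?_) fun t _ ↦ ?_
  · obtain ⟨k, hk, h02, h03, h12, h13⟩ := hc t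
    have h1 := Real.sqrt_pos.2 (add_sq_sub_pos hr hrR hk)
    have h2 := Real.sqrt_pos.2 (add_sq_sub_pos hr hrR (k := -k) (by rwa [abs_neg]))
    rw [mul_neg, sub_neg_eq_add] at h2
    fin_cases i <;> fin_cases j <;> first | exact absurd hij (by decide) | skip
    · simpa [(hd t).1] using hr
    · simpa [h02] using h2
    · simpa [h03] using h1
    · simpa [h12] using h1
    · simpa [h13] using h2
    · simpa [(hd t).2] using hR
  · obtain ⟨k, hk, h02, h03, h12, h13⟩ := hc t
    have hV := inv_sqrt_add_inv_sqrt_le hr hrR hk hB h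
    have hf0 : Finset.univ.filter (fun j : Fin 4 ↦ 0 < j) = {1, 2, 3} := by decide
    have hf1 : Finset.univ.filter (fun j : Fin 4 ↦ 1 < j) = {2, 3} := by decide
    have hf2 : Finset.univ.filter (fun j : Fin 4 ↦ 2 < j) = {3} := by decide
    have hf3 : Finset.univ.filter (fun j : Fin 4 ↦ 3 < j) = ∅ := by decide
    have hv : ∑ i, enorm2 ((testPath r R θ).v t i) ^ 2 =
        2 * ((r * (π / 2 + θ)) ^ 2 + (R * θ) ^ 2) := by
      simp only [testPath, enorm2_circularPath_v_sq, Fin.sum_univ_four]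
      simp
      ring
    rw [hv, Fin.sum_univ_four, hf0, hf1, hf2, hf3]
    simp [h02, h03, h12, h13, hd t] at hV ⊢
    linarith

namespace H1Path4

/-- The squared `L²` norm of the relative velocity of a pair. -/
def relEnergy (p : H1Path4) (i j : Fin 4) : ℝ :=
  (∫ t in (0:ℝ)..1, ((p.v t i).1 - (p.v t j).1) ^ 2) +
    ∫ t in (0:ℝ)..1, ((p.v t i).2 - (p.v t j).2) ^ 2

/-- The squared `L²` norm of the relative position of a pair. -/
def relMoment (p : H1Path4) (i j : Fin 4) : ℝ :=
  (∫ t in (0:ℝ)..1, ((p.q t i).1 - (p.q t j).1) ^ 2) +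
    ∫ t in (0:ℝ)..1, ((p.q t i).2 - (p.q t j).2) ^ 2

/-- The integrated Newtonian potential of a pair. -/
def relPotential (p : H1Path4) (i j : Fin 4) : ℝ :=
  ∫ t in (0:ℝ)..1, 1 / enorm2 (p.q t i - p.q t j)

/-- The squared `L²` norm of the relative velocity of the centers of the two binaries. -/
def centerEnergy (p : H1Path4) : ℝ :=
  (∫ t in (0:ℝ)..1, (1 / 2 * ((p.v t 2).1 + (p.v t 3).1 - ((p.v t 0).1 + (p.v t 1).1))) ^ 2) +
    ∫ t in (0:ℝ)..1, (1 / 2 * ((p.v t 2).2 + (p.v t 3).2 - ((p.v t 0).2 + (p.v t 1).2))) ^ 2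

/-- The squared `L²` norm of the relative position of the centers of the two binaries. -/
def centerMoment (p : H1Path4) : ℝ :=
  (∫ t in (0:ℝ)..1, (1 / 2 * ((p.q t 2).1 + (p.q t 3).1 - ((p.q t 0).1 + (p.q t 1).1))) ^ 2) +
    ∫ t in (0:ℝ)..1, (1 / 2 * ((p.q t 2).2 + (p.q t 3).2 - ((p.q t 0).2 + (p.q t 1).2))) ^ 2

/-- The kinetic part of the action. -/
def kineticEnergy (p : H1Path4) : ℝ :=
  1 / 2 * ∑ i, ((∫ t in (0:ℝ)..1, (p.v t i).1 ^ 2) + ∫ t in (0:ℝ)..1, (p.v t i).2 ^ 2)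

variable {p : H1Path4}

lemma relEnergy_nonneg (i j : Fin 4) : 0 ≤ p.relEnergy i j := integral_sq_add_nonneg _ _

lemma centerEnergy_nonneg : 0 ≤ p.centerEnergy := integral_sq_add_nonneg _ _

lemma relPotential_nonneg (i j : Fin 4) : 0 ≤ p.relPotential i j :=
  intervalIntegral.integral_nonneg zero_le_one fun _ _ ↦
    div_nonneg zero_le_one (Real.sqrt_nonneg _)

lemma kineticEnergy_add_relPotential_le {U : ℝ} (hU : 0 ≤ U) (h : action p ≤ ENNReal.ofReal U) :
    p.kineticEnergy + (p.relPotential 0 1 + p.relPotential 0 2 + p.relPotential 0 3 +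
      p.relPotential 1 2 + p.relPotential 1 3 + p.relPotential 2 3) ≤ U := by
  have hf0 : Finset.univ.filter (fun j : Fin 4 ↦ 0 < j) = {1, 2, 3} := by decide
  have hf1 : Finset.univ.filter (fun j : Fin 4 ↦ 1 < j) = {2, 3} := by decide
  have hf2 : Finset.univ.filter (fun j : Fin 4 ↦ 2 < j) = {3} := by decide
  have hf3 : Finset.univ.filter (fun j : Fin 4 ↦ 3 < j) = ∅ := by decide
  have := action_toReal_bound hU h
  rw [Fin.sum_univ_four (f := fun i ↦ ∑ j ∈ Finset.univ.filter (fun j ↦ i < j), _),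
    hf0, hf1, hf2, hf3] at this
  simp only [Finset.sum_empty, Finset.sum_singleton, Finset.mem_insert, Finset.mem_singleton,
    Fin.reduceEq, or_self, not_false_eq_true, Finset.sum_insert] at this
  simp only [kineticEnergy, relPotential]
  linarith

section PairBounds

variable {i j : Fin 4} {a C : ℝ}

lemma le_of_collision (htop : action p ≠ ∞) (hij : i ≠ j) {τ : ℝ} (hτ : τ ∈ Icc (0:ℝ) 1)
    (hc : p.q τ i = p.q τ j) (ha : 0 ≤ a) (hC : 4 * C ^ 3 ≤ 27 * (a * π ^ 2)) :
    C ≤ a * p.relEnergy i j + p.relPotential i j :=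
  ((p.isPrim_fst i).sub (p.isPrim_fst j)).collision_bound ((p.isPrim_snd i).sub (p.isPrim_snd j))
    hτ (sub_eq_zero.2 (congrArg Prod.fst hc)) (sub_eq_zero.2 (congrArg Prod.snd hc))
    (ae_dist_pos htop hij) (intervalIntegrable_inv_dist htop hij) ha hC

lemma le_of_relMoment (htop : action p ≠ ∞) (hij : i ≠ j) (ha : 0 ≤ a)
    (hC : 4 * C ^ 3 ≤ 27 * a) : C ≤ a * p.relMoment i j + p.relPotential i j :=
  ((p.isPrim_fst i).sub (p.isPrim_fst j)).moment_bound ((p.isPrim_snd i).sub (p.isPrim_snd j))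
    (ae_dist_pos htop hij) (intervalIntegrable_inv_dist htop hij) ha hC

lemma le_of_rotation (htop : action p ≠ ∞) (hij : i ≠ j) (ha : 0 ≤ a) {φ : ℝ}
    (hw : φ ^ 2 * p.relMoment i j ≤ p.relEnergy i j) (hC : 4 * C ^ 3 ≤ 27 * (a * φ ^ 2)) :
    C ≤ a * p.relEnergy i j + p.relPotential i j :=
  ((p.isPrim_fst i).sub (p.isPrim_fst j)).rotation_bound ((p.isPrim_snd i).sub (p.isPrim_snd j))
    (ae_dist_pos htop hij) (intervalIntegrable_inv_dist htop hij) ha hw hC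

end PairBounds

lemma binaries_le_kineticEnergy :
    1 / 4 * p.relEnergy 0 1 + 1 / 4 * p.relEnergy 2 3 + 1 / 2 * p.centerEnergy ≤
      p.kineticEnergy := by
  have h1 := kinetic_split_binaries p.isPrim_fst
  have h2 := kinetic_split_binaries p.isPrim_snd
  rw [kineticEnergy, Finset.sum_add_distrib, relEnergy, relEnergy, centerEnergy]
  linarith

lemma cross_le_kineticEnergy {i j : Fin 4} (hi : i = 0 ∨ i = 1) (hj : j = 2 ∨ j = 3) :
    1 / 6 * p.relEnergy i j + 1 / 8 * p.relEnergy 0 1 + 1 / 8 * p.relEnergy 2 3 ≤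
      p.kineticEnergy := by
  have h1 := kinetic_split_cross p.isPrim_fst hi hj
  have h2 := kinetic_split_cross p.isPrim_snd hi hj
  rw [kineticEnergy, Finset.sum_add_distrib, relEnergy, relEnergy, relEnergy]
  linarith

lemma cross_relMoment_le :
    p.relMoment 0 2 + p.relMoment 0 3 + p.relMoment 1 2 + p.relMoment 1 3 ≤
      p.relMoment 0 1 + p.relMoment 2 3 + 4 * p.centerMoment := by
  have h1 := cross_moment_le p.isPrim_fst
  have h2 := cross_moment_le p.isPrim_snd
  simp only [relMoment, centerMoment]
  linarith

section Wirtinger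

variable {θ : ℝ}

lemma inner_wirtinger (h : inAdm (QE2set θ) p) (hθ : 0 < θ) (hθ' : θ < π / 2) :
    (π / 2 - θ) ^ 2 * p.relMoment 0 1 ≤ p.relEnergy 0 1 := by
  obtain ⟨-, ⟨a₁, b₁, c₁, -, -, h0⟩, ⟨a₂, b₂, c₂, -, -, h1⟩⟩ := h
  refine ((p.isPrim_fst 0).sub (p.isPrim_fst 1)).wirtinger_lines
    ((p.isPrim_snd 0).sub (p.isPrim_snd 1)) (by linarith) (by linarith) ?_ ?_
  · simp [h0]
  · simp [h1, rotV, sin_pi_div_two_sub, cos_pi_div_two_sub]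
    ring

lemma outer_wirtinger (h : inAdm (QE2set θ) p) (hθ : 0 < θ) (hθ' : θ < π / 2) :
    θ ^ 2 * p.relMoment 2 3 ≤ p.relEnergy 2 3 := by
  obtain ⟨-, ⟨a₁, b₁, c₁, -, -, h0⟩, ⟨a₂, b₂, c₂, -, -, h1⟩⟩ := h
  rw [relMoment, relEnergy, add_comm, add_comm (∫ t in (0:ℝ)..1, ((p.v t 2).1 - _) ^ 2)]
  refine ((p.isPrim_snd 2).sub (p.isPrim_snd 3)).wirtinger_lines
    ((p.isPrim_fst 2).sub (p.isPrim_fst 3)) hθ hθ' ?_ ?_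
  · simp [h0]
  · simp [h1, rotV]
    ring

lemma center_wirtinger (h : inAdm (QE2set θ) p) (hθ : 0 < θ) (hθ' : θ < π / 2) :
    θ ^ 2 * p.centerMoment ≤ p.centerEnergy := by
  obtain ⟨-, ⟨a₁, b₁, c₁, -, -, h0⟩, ⟨a₂, b₂, c₂, -, -, h1⟩⟩ := h
  refine ((((p.isPrim_fst 2).add (p.isPrim_fst 3)).sub
    ((p.isPrim_fst 0).add (p.isPrim_fst 1))).const_mul (1 / 2)).wirtinger_lines
    ((((p.isPrim_snd 2).add (p.isPrim_snd 3)).sub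
    ((p.isPrim_snd 0).add (p.isPrim_snd 1))).const_mul (1 / 2)) hθ hθ' ?_ ?_
  · simp [h0]
  · simp [h1, rotV]
    ring

end Wirtinger

end H1Path4

/-- Two-thirds power of the angle, together with the numerical bounds on the angle. -/
lemma exists_cube_eq_sq {θ : ℝ} (h0 : 0 < θ) (h1 : θ ≤ 0.0664 * π) :
    ∃ m : ℝ, 0 < m ∧ m ^ 3 = θ ^ 2 ∧ m ≤ 0.3519 ∧ θ ≤ 0.2086023 := by
  have hθ : θ ≤ 0.2086023 := by linarith [pi_lt_d4]
  refine ⟨(θ ^ 2) ^ (1 / 3 : ℝ), by positivity, ?_, ?_, hθ⟩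
  · rw [← Real.rpow_natCast, ← Real.rpow_mul (by positivity)]
    norm_num
  · refine le_of_pow_le_pow_left₀ (n := 3) (by norm_num) (by norm_num) ?_
    rw [← Real.rpow_natCast ((θ ^ 2) ^ (1 / 3 : ℝ)), ← Real.rpow_mul (by positivity)]
    norm_num
    nlinarith

lemma exists_action_le {θ m : ℝ} (h0 : 0 < θ) (hθ : θ ≤ 0.2086023) (hm0 : 0 < m)
    (hm : m ^ 3 = θ ^ 2) (hm1 : m ≤ 0.3519) :
    ∃ p, inAdm (QE2set θ) p ∧ action p ≤ ENNReal.ofReal (1.7485 + 5.229 * m) := by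
  obtain ⟨R, hR⟩ : ∃ R, R = 1.31 / m := ⟨_, rfl⟩
  have hRm : R * m = 1.31 := by rw [hR]; field_simp
  have hR1 : 3.7 ≤ R := by rw [hR, le_div_iff₀ hm0]; linarith
  have hR0 : 0 < R := by linarith
  refine ⟨testPath 0.43 R θ, testPath_inAdm (by norm_num) hR0.le,
    (action_testPath_le (B := 2.05 / R) (by norm_num) (by linarith) (by positivity) ?_).trans
      (ENNReal.ofReal_le_ofReal ?_)⟩
  · rw [div_pow, div_mul_eq_mul_div, le_div_iff₀ (by positivity)]
    have hR2 : 13.69 ≤ R ^ 2 := by nlinarith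
    nlinarith [sq_nonneg (R ^ 2), mul_nonneg (sub_nonneg.2 hR2) (sub_nonneg.2 hR2)]
  · have h1 : (R * θ) ^ 2 = 1.31 ^ 2 * m := by
      rw [mul_pow, ← hm, ← hRm]; ring
    have h2 : (2 * R)⁻¹ = m / 2.62 := by
      rw [hR]; field_simp; norm_num
    have h3 : 2 * (2.05 / R) = 4.1 / 1.31 * m := by
      rw [hR]; field_simp
      norm_num
    have h4 : (0.43 * (π / 2 + θ)) ^ 2 ≤ (0.43 * 1.7794023) ^ 2 := by
      have := pi_lt_d4
      have := pi_pos
      gcongr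
      linarith
    rw [h1, h2, h3]
    norm_num at h4 ⊢
    linarith

/-- For `0 < θ ≤ 0.0664·π`, every action minimizer of `A` over
`P(Q_S, Q_{E₂})` is collision-free on `[0,1]`. -/
theorem statement2 (θ : ℝ) (hθ0 : 0 < θ) (hθ1 : θ ≤ 0.0664 * π)
    (p : H1Path4) (hp : isMin (QE2set θ) p) :
    ∀ t ∈ Icc (0:ℝ) 1, ∀ i j : Fin 4, i ≠ j → p.q t i ≠ p.q t j := by
  obtain ⟨m, hm0, hm, hm1, hθ⟩ := exists_cube_eq_sq hθ0 hθ1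
  obtain ⟨p', hp', hU⟩ := exists_action_le hθ0 hθ hm0 hm hm1
  have hact := (hp.2 p' hp').trans hU
  have htop : action p ≠ ∞ := ne_top_of_le_ne_top ENNReal.ofReal_ne_top hact
  have htot := H1Path4.kineticEnergy_add_relPotential_le (by positivity) hact
  have hpi := pi_gt_d4
  have hθπ : θ < π / 2 := by linarith
  have hφ : 1.3621 ≤ π / 2 - θ := by linarith
  have hφ2 : 1.8553 ≤ (π / 2 - θ) ^ 2 := by nlinarith
  have hpi2 : 9.869 ≤ π ^ 2 := by nlinarith
  have hθ2 : θ ^ 2 ≤ 0.04352 := by nlinarith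
  have hx := H1Path4.inner_wirtinger hp.1 hθ0 hθπ
  have hy := H1Path4.outer_wirtinger hp.1 hθ0 hθπ
  have hz := H1Path4.center_wirtinger hp.1 hθ0 hθπ
  have hV := fun i j ↦ p.relPotential_nonneg i j
  have hE := fun i j ↦ p.relEnergy_nonneg i j
  have hm3 : 4 * (0.944 * m) ^ 3 ≤ 27 * (1 / 8 * θ ^ 2) := by
    rw [mul_pow, hm]; nlinarith [sq_nonneg θ]
  suffices key : ∀ t ∈ Icc (0:ℝ) 1, ∀ i j : Fin 4, i < j → p.q t i ≠ p.q t j by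
    intro t ht i j hij
    rcases lt_or_gt_of_ne hij with hlt | hgt
    · exact key t ht i j hlt
    · exact (key t ht j i hgt).symm
  have inner : ∀ t ∈ Icc (0:ℝ) 1, p.q t 0 ≠ p.q t 1 := by
    intro t ht hc
    have h01 := p.le_of_collision htop (by decide) ht hc (a := 0.247) (C := 2.54) (by norm_num)
      (by linarith)
    have hcross : ∀ i j : Fin 4, i ≠ j →
        0.944 * m ≤ 1 / 8 * θ ^ 2 * p.relMoment i j + p.relPotential i j := fun i j hij ↦
      p.le_of_relMoment htop hij (by positivity) hm3
    have h02 := hcross 0 2 (by decide)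
    have h03 := hcross 0 3 (by decide)
    have h12 := hcross 1 2 (by decide)
    have h13 := hcross 1 3 (by decide)
    have hM := mul_le_mul_of_nonneg_left p.cross_relMoment_le (by positivity : 0 ≤ 1 / 8 * θ ^ 2)
    have hM0 : 0 ≤ p.relMoment 0 1 := integral_sq_add_nonneg _ _
    have hx' : 1 / 8 * θ ^ 2 * p.relMoment 0 1 ≤ 0.003 * p.relEnergy 0 1 := by
      nlinarith [mul_le_mul_of_nonneg_right (by linarith :
        1 / 8 * θ ^ 2 ≤ 0.003 * (π / 2 - θ) ^ 2) hM0]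
    have := p.binaries_le_kineticEnergy
    linarith [hV 2 3, hE 2 3]
  have outer : ∀ t ∈ Icc (0:ℝ) 1, p.q t 2 ≠ p.q t 3 := by
    intro t ht hc
    have h23 := p.le_of_collision htop (by decide) ht hc (a := 1 / 4) (C := 2.55) (by norm_num)
      (by linarith)
    have h01 := p.le_of_rotation htop (by decide) (a := 1 / 4) (C := 1.46) (by norm_num) hx
      (by linarith)
    have := p.binaries_le_kineticEnergy
    linarith [hV 0 2, hV 0 3, hV 1 2, hV 1 3, p.centerEnergy_nonneg]
  have cross : ∀ t ∈ Icc (0:ℝ) 1, ∀ i j : Fin 4, (i = 0 ∨ i = 1) → (j = 2 ∨ j = 3) →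
      p.q t i ≠ p.q t j := by
    intro t ht i j hi hj hc
    have hij : i ≠ j := by
      rcases hi with rfl | rfl <;> rcases hj with rfl | rfl <;> decide
    have h1 := p.le_of_collision htop hij ht hc (a := 1 / 6) (C := 2.23) (by norm_num)
      (by linarith)
    have h01 := p.le_of_rotation htop (by decide) (a := 1 / 8) (C := 1.16) (by norm_num) hx
      (by linarith)
    have h23 := p.le_of_rotation htop (by decide) (a := 1 / 8) (by norm_num) hy hm3
    have := p.cross_le_kineticEnergy hi hj
    rcases hi with rfl | rfl <;> rcases hj with rfl | rfl <;>
      linarith [hV 0 2, hV 0 3, hV 1 2, hV 1 3]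
  intro t ht i j hij
  fin_cases i <;> fin_cases j <;> first | exact absurd hij (by decide) | skip
  · exact inner t ht
  · exact cross t ht 0 2 (by simp) (by simp)
  · exact cross t ht 0 3 (by simp) (by simp)
  · exact cross t ht 1 2 (by simp) (by simp)
  · exact cross t ht 1 3 (by simp) (by simp)
  · exact outer t ht

end
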